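/- Let Γ be a matroid complex of dimension d−1 on [n]. Then the Stanley-Reisner ideal I_Γ admits a deformation M that is a generic, Cohen-Macaulay monomial ideal. -/

import Mathlib

open Finset

open scoped Classical

set_option synthInstance.maxHeartbeats 1000000

/-- The monomial `x^a` in `k[x_1,…,x_n]` with exponent vector `a : Fin n → ℕ`. -/
noncomputable def mono (k : Type*) [CommSemiring k] {n : ℕ} (a : Fin n → ℕ) :
    MvPolynomial (Fin n) k :=
  MvPolynomial.monomial (Finsupp.equivFunOnFinite.symm a) 1

/-- The monomial ideal generated by the monomials with exponent vectors in `G`. -/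
noncomputable def monIdeal (k : Type*) [CommSemiring k] {n : ℕ}
    (G : Finset (Fin n → ℕ)) : Ideal (MvPolynomial (Fin n) k) :=
  Ideal.span ((fun a => mono k a) '' (G : Set (Fin n → ℕ)))

/-- Exponent vector of the lcm of the monomials with exponents in `σ`. -/
def lcmExp {n : ℕ} (σ : Finset (Fin n → ℕ)) : Fin n → ℕ :=
  fun i => σ.sup (fun a => a i)

/-- `c` strictly divides `b`: whenever `c` has positive degree in a variable,
its degree there is strictly smaller than that of `b`. -/
def StrictlyDivides {n : ℕ} (c b : Fin n → ℕ) : Prop :=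
  ∀ i, 0 < c i → c i < b i

/-- `G` is the set of exponent vectors of the minimal generators of a *generic*
monomial ideal: no generator divides another, and for any two distinct
generators with the same positive degree in some variable there is a third
generator strictly dividing their lcm. -/
def IsGeneric {n : ℕ} (G : Finset (Fin n → ℕ)) : Prop :=
  (∀ a ∈ G, ∀ b ∈ G, a ≤ b → a = b) ∧
  ∀ a ∈ G, ∀ b ∈ G, a ≠ b → (∃ h, a h = b h ∧ 0 < a h) →
    ∃ c ∈ G, c ≠ a ∧ c ≠ b ∧ StrictlyDivides c (fun i => max (a i) (b i))

/-- `σ ⊆ G` is a face of the Scarf complex of the monomial ideal with minimal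
generating exponents `G`: its lcm is attained by no other subset of `G`. -/
def ScarfFace {n : ℕ} (G σ : Finset (Fin n → ℕ)) : Prop :=
  σ ⊆ G ∧ ∀ τ ⊆ G, τ ≠ σ → lcmExp τ ≠ lcmExp σ

/-- The dimension (as an integer, so the empty-complex value `-1` is allowed)
of the Scarf complex `Δ_M`: one less than the largest cardinality of a face. -/
noncomputable def scarfDim {n : ℕ} (G : Finset (Fin n → ℕ)) : ℤ :=
  (((G.powerset.filter (fun σ => ScarfFace G σ)).sup Finset.card : ℕ) : ℤ) - 1

/-- `σ` is a face of `V(M)`, the simplicial complex whose Stanley-Reisner ideal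
is `rad M`: no generator of `M` has support contained in `σ`. -/
def VFace {n : ℕ} (G : Finset (Fin n → ℕ)) (σ : Finset (Fin n)) : Prop :=
  ∀ a ∈ G, ¬ (Finset.univ.filter (fun i => 0 < a i) ⊆ σ)

/-- The dimension of `V(M)` as an integer. -/
noncomputable def vDim {n : ℕ} (G : Finset (Fin n → ℕ)) : ℤ :=
  ((((Finset.univ : Finset (Fin n)).powerset.filter (fun σ => VFace G σ)).sup
    Finset.card : ℕ) : ℤ) - 1

/-- The quotient `S/I` of the polynomial ring `S = k[x_1,…,x_n]` is
Cohen-Macaulay: some regular sequence on `S/I` consisting of elements of the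
irrelevant maximal ideal `⟨x_1,…,x_n⟩` has length equal to the Krull dimension
of `S/I`. -/
def IsCMQuotient (k : Type*) [Field k] {n : ℕ}
    (I : Ideal (MvPolynomial (Fin n) k)) : Prop :=
  ∃ rs : List (MvPolynomial (Fin n) k),
    (∀ r ∈ rs, r ∈ Ideal.span (Set.range (MvPolynomial.X : Fin n → MvPolynomial (Fin n) k))) ∧
    RingTheory.Sequence.IsRegular (MvPolynomial (Fin n) k ⧸ I)
      (rs.map (Ideal.Quotient.mk I)) ∧
    (rs.length : WithBot (WithTop ℕ)) = ringKrullDim (MvPolynomial (Fin n) k ⧸ I)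

/-- A simplicial complex on the vertex set `V ⊆ Fin n`, given as its finite set of faces. -/
def IsComplexOn {n : ℕ} (V : Finset (Fin n)) (Γ : Finset (Finset (Fin n))) : Prop :=
  (∀ i ∈ V, ({i} : Finset (Fin n)) ∈ Γ) ∧ (∀ σ ∈ Γ, σ ⊆ V) ∧
    (∀ σ ∈ Γ, ∀ τ ⊆ σ, τ ∈ Γ)

/-- `σ` is a minimal non-face of `Γ`. -/
def IsMinNonFace {n : ℕ} (Γ : Finset (Finset (Fin n))) (σ : Finset (Fin n)) : Prop :=
  σ ∉ Γ ∧ ∀ i ∈ σ, σ.erase i ∈ Γ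

/-- `σ` is a facet (maximal face) of `Γ`. -/
def IsFacet {n : ℕ} (Γ : Finset (Finset (Fin n))) (σ : Finset (Fin n)) : Prop :=
  σ ∈ Γ ∧ ∀ τ ∈ Γ, σ ⊆ τ → τ = σ

/-- `Γ` has (simplicial) dimension `d - 1`. -/
def HasDim {n : ℕ} (Γ : Finset (Finset (Fin n))) (d : ℕ) : Prop :=
  (∀ σ ∈ Γ, σ.card ≤ d) ∧ (∃ σ ∈ Γ, σ.card = d)

/-- The finite set of minimal non-faces of `Γ`. -/
noncomputable def minNonFaces {n : ℕ} (Γ : Finset (Finset (Fin n))) :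
    Finset (Finset (Fin n)) :=
  (Finset.univ : Finset (Finset (Fin n))).filter (fun σ => IsMinNonFace Γ σ)

/-- Matroid complex on vertex set `V` (circuit-exchange axiom for minimal non-faces). -/
def IsMatroidOn {n : ℕ} (V : Finset (Fin n)) (Γ : Finset (Finset (Fin n))) : Prop :=
  IsComplexOn V Γ ∧ ∀ α β, IsMinNonFace Γ α → IsMinNonFace Γ β → α ≠ β →
    ∀ i ∈ α ∩ β, ∃ γ, IsMinNonFace Γ γ ∧ γ ⊆ (α ∪ β).erase i

open MvPolynomial
open scoped Pointwise

section RegularOnQuotient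

variable {R : Type*} [CommRing R]

/-- `rs` is a weakly regular sequence on `R ⧸ I`, phrased through the ideal `I`. -/
def IsRegularModulo : Ideal R → List R → Prop
  | _, [] => True
  | I, r :: rs => (∀ f, r * f ∈ I → f ∈ I) ∧ IsRegularModulo (I ⊔ Ideal.span {r}) rs

theorem isRegularModulo_top (rs : List R) : IsRegularModulo (⊤ : Ideal R) rs := by
  induction rs with
  | nil => trivial
  | cons r rs ih => exact ⟨fun _ _ => trivial, by rwa [top_sup_eq]⟩

theorem mem_sup_span_singleton_iff {I : Ideal R} {x f : R} :
    f ∈ I ⊔ Ideal.span {x} ↔ ∃ g, f - x * g ∈ I := by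
  rw [sup_comm, Ideal.mem_span_singleton_sup]
  constructor
  · rintro ⟨a, b, hb, rfl⟩
    exact ⟨a, by simpa [mul_comm] using hb⟩
  · rintro ⟨g, hg⟩
    exact ⟨g, _, hg, by ring⟩

/-- A sequence regular modulo `I : x` and modulo `I + (x)` is regular modulo `I`. -/
theorem IsRegularModulo.of_colon_of_sup (x : R) (rs : List R) :
    ∀ {I I' : Ideal R}, (∀ f, f ∈ I' ↔ x * f ∈ I) → IsRegularModulo I' rs →
      IsRegularModulo (I ⊔ Ideal.span {x}) rs → IsRegularModulo I rs := by
  induction rs with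
  | nil => intros; trivial
  | cons r rs ih =>
    rintro I I' hcolon ⟨hreg', hrest'⟩ ⟨hreg, hrest⟩
    refine ⟨fun f hf => ?_, ?_⟩
    · obtain ⟨g, hg⟩ := mem_sup_span_singleton_iff.1 (hreg f (Ideal.mem_sup_left hf))
      have h : x * (r * g) ∈ I := by
        have := I.sub_mem hf (I.mul_mem_left r hg)
        convert this using 1
        ring
      have h' := (hcolon g).1 (hreg' g ((hcolon _).2 h))
      simpa using I.add_mem hg h'
    · refine ih (I' := I' ⊔ Ideal.span {r}) (fun f => ?_) hrest' ?_
      · rw [mem_sup_span_singleton_iff, mem_sup_span_singleton_iff]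
        constructor
        · rintro ⟨g, hg⟩
          refine ⟨x * g, ?_⟩
          have := (hcolon _).1 hg
          convert this using 1
          ring
        · rintro ⟨h, hh⟩
          have hmem : r * h ∈ I ⊔ Ideal.span {x} := by
            refine mem_sup_span_singleton_iff.2 ⟨f, ?_⟩
            have := I.neg_mem hh
            convert this using 1
            ring
          obtain ⟨g, hg⟩ := mem_sup_span_singleton_iff.1 (hreg h hmem)
          refine ⟨g, (hcolon _).2 ?_⟩
          have := I.add_mem hh (I.mul_mem_left r hg)
          convert this using 1
          ring
      · rwa [sup_right_comm]

theorem IsRegularModulo.isWeaklyRegular {I : Ideal R} {rs : List R}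
    (h : IsRegularModulo I rs) : RingTheory.Sequence.IsWeaklyRegular (R ⧸ I) rs := by
  induction rs generalizing I with
  | nil => exact RingTheory.Sequence.IsWeaklyRegular.nil _ _
  | cons r rs ih =>
    obtain ⟨hreg, hrest⟩ := h
    refine RingTheory.Sequence.IsWeaklyRegular.cons ?_ ?_
    · rw [isSMulRegular_quotient_iff_mem_of_smul_mem]
      exact hreg
    · have hmap : r • (⊤ : Submodule R (R ⧸ I)) = Submodule.map I.mkQ (Ideal.span {r}) := by
        rw [← Ideal.submodule_span_eq, Submodule.map_span, Set.image_singleton]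
        ext y
        rw [Submodule.mem_smul_pointwise_iff_exists, Submodule.mem_span_singleton]
        constructor
        · rintro ⟨b, -, rfl⟩
          obtain ⟨b, rfl⟩ := Submodule.mkQ_surjective _ b
          exact ⟨b, by rw [← map_smul, ← map_smul, smul_eq_mul, smul_eq_mul, mul_comm]⟩
        · rintro ⟨b, rfl⟩
          exact ⟨I.mkQ b, trivial,
            by rw [← map_smul, ← map_smul, smul_eq_mul, smul_eq_mul, mul_comm]⟩
      exact (((Submodule.quotEquivOfEq _ _ hmap).trans
        (Submodule.quotientQuotientEquivQuotientSup I (Ideal.span {r}))).isWeaklyRegular_congr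
          rs).2 (ih hrest)

end RegularOnQuotient

section MonomialIdeals

variable (k : Type*) [Field k] {n : ℕ}

/-- The ideal spanned by the monomials with exponents in `U`. -/
noncomputable def spanMonomials (U : Set (Fin n →₀ ℕ)) : Ideal (MvPolynomial (Fin n) k) :=
  Ideal.span ((fun c => monomial c 1) '' U)

variable {k}

theorem mem_spanMonomials_iff {U : Set (Fin n →₀ ℕ)} (hU : IsUpperSet U)
    {f : MvPolynomial (Fin n) k} : f ∈ spanMonomials k U ↔ ∀ c, coeff c f ≠ 0 → c ∈ U := by
  rw [spanMonomials, mem_ideal_span_monomial_image]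
  simp only [mem_support_iff]
  exact forall₂_congr fun c _ =>
    ⟨fun ⟨t, ht, htc⟩ => hU htc ht, fun hc => ⟨c, hc, le_rfl⟩⟩

theorem spanMonomials_eq_top {U : Set (Fin n →₀ ℕ)} (h : 0 ∈ U) : spanMonomials k U = ⊤ :=
  (Ideal.eq_top_iff_one _).2 (Ideal.subset_span ⟨0, h, rfl⟩)

theorem spanMonomials_sup_span_monomial {U V : Set (Fin n →₀ ℕ)} (hV : IsUpperSet V)
    {a : Fin n →₀ ℕ} (h : ∀ c, c ∈ V ↔ c ∈ U ∨ a ≤ c) :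
    spanMonomials k U ⊔ Ideal.span {monomial a 1} = spanMonomials k V := by
  have hsup : spanMonomials k U ⊔ Ideal.span {monomial a 1} = spanMonomials k (U ∪ {a}) := by
    rw [spanMonomials, spanMonomials, Set.image_union, Ideal.span_union, Set.image_singleton]
  rw [hsup]
  apply le_antisymm
  · refine Ideal.span_mono (Set.image_mono ?_)
    rintro c (hc | rfl)
    · exact (h c).2 (Or.inl hc)
    · exact (h _).2 (Or.inr le_rfl)
  · intro f hf
    rw [spanMonomials, mem_ideal_span_monomial_image]
    intro c hc
    rcases (h c).1 ((mem_spanMonomials_iff hV).1 hf c (mem_support_iff.1 hc)) with hc | hc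
    · exact ⟨c, Or.inl hc, le_rfl⟩
    · exact ⟨a, Or.inr rfl, hc⟩

theorem mem_spanMonomials_iff_monomial_mul_mem {U V : Set (Fin n →₀ ℕ)} (hU : IsUpperSet U)
    (hV : IsUpperSet V) {a : Fin n →₀ ℕ} (h : ∀ c, c ∈ V ↔ a + c ∈ U)
    (f : MvPolynomial (Fin n) k) :
    f ∈ spanMonomials k V ↔ monomial a 1 * f ∈ spanMonomials k U := by
  rw [mem_spanMonomials_iff hU, mem_spanMonomials_iff hV]
  constructor
  · intro hf c hc
    rw [coeff_monomial_mul'] at hc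
    split_ifs at hc with hac
    · have := (h _).1 (hf (c - a) (by simpa using hc))
      rwa [add_tsub_cancel_of_le hac] at this
    · exact absurd rfl hc
  · intro hf c hc
    exact (h c).2 (hf (a + c) (by simpa [coeff_monomial_mul] using hc))

/-- Splitting off a variable: regularity modulo a monomial ideal follows from regularity modulo
its colon by `x_a` and modulo its sum with `(x_a)`. -/
theorem IsRegularModulo.of_variable {U V W : Set (Fin n →₀ ℕ)} (hU : IsUpperSet U)
    (hV : IsUpperSet V) (hW : IsUpperSet W) (a : Fin n)
    (hcolon : ∀ c, c ∈ V ↔ Finsupp.single a 1 + c ∈ U) (hsup : ∀ c, c ∈ W ↔ c ∈ U ∨ 0 < c a)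
    {rs : List (MvPolynomial (Fin n) k)} (hrsV : IsRegularModulo (spanMonomials k V) rs)
    (hrsW : IsRegularModulo (spanMonomials k W) rs) :
    IsRegularModulo (spanMonomials k U) rs := by
  refine IsRegularModulo.of_colon_of_sup (monomial (Finsupp.single a 1) 1) rs
    (mem_spanMonomials_iff_monomial_mul_mem hU hV hcolon) hrsV ?_
  rwa [spanMonomials_sup_span_monomial hW]
  intro c
  rw [hsup, Finsupp.single_le_iff, Nat.one_le_iff_ne_zero, Nat.pos_iff_ne_zero]

end MonomialIdeals

section CoordinateSubspaces

variable {n : ℕ}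

/-- Exponents of the monomials involving a variable outside `F`. -/
def exponentsOffFace (F : Finset (Fin n)) : Set (Fin n →₀ ℕ) := {c | ∃ j ∉ F, 0 < c j}

/-- Exponents of the monomials involving a variable outside `F`, or all the variables in `G`. -/
def exponentsOffFaceOrAbove (F G : Finset (Fin n)) : Set (Fin n →₀ ℕ) :=
  {c | (∃ j ∉ F, 0 < c j) ∨ ∀ i ∈ G, 0 < c i}

theorem isUpperSet_exponentsOffFace (F : Finset (Fin n)) : IsUpperSet (exponentsOffFace F) :=
  fun _ _ hcc ⟨j, hj, hc⟩ => ⟨j, hj, hc.trans_le (hcc j)⟩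

theorem isUpperSet_exponentsOffFaceOrAbove (F G : Finset (Fin n)) :
    IsUpperSet (exponentsOffFaceOrAbove F G) := by
  rintro c c' hcc (⟨j, hj, hc⟩ | hc)
  · exact Or.inl ⟨j, hj, hc.trans_le (hcc j)⟩
  · exact Or.inr fun i hi => (hc i hi).trans_le (hcc i)

variable (k : Type*) [Field k] (n)

/-- The elementary symmetric polynomials of degrees `m, m - 1, …, 1`. -/
noncomputable def esymmList : ℕ → List (MvPolynomial (Fin n) k)
  | 0 => []
  | m + 1 => esymm (Fin n) k (m + 1) :: esymmList m

theorem length_esymmList (m : ℕ) : (esymmList n k m).length = m := by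
  induction m with
  | zero => rfl
  | succ m ih => simp [esymmList, ih]

variable {k n}

theorem mem_span_range_X_of_mem_esymmList {m : ℕ} {r : MvPolynomial (Fin n) k}
    (hr : r ∈ esymmList n k m) :
    r ∈ Ideal.span (Set.range (X : Fin n → MvPolynomial (Fin n) k)) := by
  induction m with
  | zero => simp [esymmList] at hr
  | succ m ih =>
    rcases List.mem_cons.1 hr with rfl | hr
    · refine Ideal.sum_mem _ fun t ht => ?_
      obtain ⟨i, hi⟩ : t.Nonempty := by
        rw [← Finset.card_pos, (Finset.mem_powersetCard.1 ht).2]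
        exact m.succ_pos
      exact Ideal.mem_of_dvd _ (Finset.dvd_prod_of_mem _ hi) (Ideal.subset_span ⟨i, rfl⟩)
    · exact ih hr

theorem prod_X_eq_monomial (F : Finset (Fin n)) :
    ∏ i ∈ F, (X i : MvPolynomial (Fin n) k) = monomial (∑ i ∈ F, Finsupp.single i 1) 1 := by
  rw [monomial_sum_one]
  rfl

theorem sum_single_apply (F : Finset (Fin n)) (i : Fin n) :
    (∑ j ∈ F, Finsupp.single j 1 : Fin n →₀ ℕ) i = if i ∈ F then 1 else 0 := by
  simp [Finsupp.finsetSum_apply, Finsupp.single_apply]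

theorem esymm_sub_prod_mem (F : Finset (Fin n)) :
    esymm (Fin n) k F.card - ∏ i ∈ F, X i ∈ spanMonomials k (exponentsOffFace F) := by
  have hF : F ∈ Finset.powersetCard F.card (Finset.univ : Finset (Fin n)) := by simp
  rw [esymm, ← Finset.sum_erase_eq_sub hF]
  refine Ideal.sum_mem _ fun t ht => ?_
  rw [Finset.mem_erase, Finset.mem_powersetCard] at ht
  obtain ⟨j, hjt, hjF⟩ : ∃ j ∈ t, j ∉ F := by
    by_contra! h
    exact ht.1 (Finset.eq_of_subset_of_card_le h ht.2.2.ge)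
  rw [prod_X_eq_monomial]
  refine Ideal.subset_span ⟨_, ⟨j, hjF, ?_⟩, rfl⟩
  simp [sum_single_apply, hjt]

theorem isRegularModulo_exponentsOffFaceOrAbove {rs : List (MvPolynomial (Fin n) k)}
    {F : Finset (Fin n)}
    (h : ∀ a ∈ F, IsRegularModulo (spanMonomials k (exponentsOffFace (F.erase a))) rs)
    (G : Finset (Fin n)) (hG : G ⊆ F) :
    IsRegularModulo (spanMonomials k (exponentsOffFaceOrAbove F G)) rs := by
  induction G using Finset.induction_on with
  | empty =>
    rw [spanMonomials_eq_top (Or.inr (by simp))]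
    exact isRegularModulo_top rs
  | insert a G ha ih =>
    have haF : a ∈ F := hG (Finset.mem_insert_self a G)
    refine IsRegularModulo.of_variable (isUpperSet_exponentsOffFaceOrAbove _ _)
      (isUpperSet_exponentsOffFaceOrAbove F G) (isUpperSet_exponentsOffFace _) a
      (fun c => ?_) (fun c => ?_) (ih ((Finset.subset_insert a G).trans hG)) (h a haF)
    · have hadd : ∀ j, j ≠ a → (Finsupp.single a 1 + c : Fin n →₀ ℕ) j = c j := fun j hj => by
        simp [hj]
      refine or_congr (exists_congr fun j => and_congr_right fun hj => ?_) ?_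
      · rw [hadd j (by rintro rfl; exact hj haF)]
      · rw [Finset.forall_mem_insert]
        refine ⟨fun hc => ⟨by simp, fun i hi => ?_⟩, fun hc i hi => ?_⟩
        · rw [hadd i (by rintro rfl; exact ha hi)]
          exact hc i hi
        · rw [← hadd i (by rintro rfl; exact ha hi)]
          exact hc.2 i hi
    · simp only [exponentsOffFace, exponentsOffFaceOrAbove, Set.mem_ofPred_eq, Finset.mem_erase,
        Finset.forall_mem_insert]
      constructor
      · rintro ⟨j, hj, hc⟩
        by_cases hja : j = a
        · exact Or.inr (hja ▸ hc)
        · exact Or.inl (Or.inl ⟨j, fun hjF => hj ⟨hja, hjF⟩, hc⟩)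
      · rintro ((⟨j, hj, hc⟩ | ⟨hc, -⟩) | hc)
        · exact ⟨j, fun h => hj h.2, hc⟩
        · exact ⟨a, by simp, hc⟩
        · exact ⟨a, by simp, hc⟩

/-- The elementary symmetric polynomials of degrees `m, …, 1` form a regular sequence on every
coordinate subspace of dimension `m`. -/
theorem isRegularModulo_exponentsOffFace (m : ℕ) (F : Finset (Fin n)) (hF : F.card = m) :
    IsRegularModulo (spanMonomials k (exponentsOffFace F)) (esymmList n k m) := by
  induction m generalizing F with
  | zero => trivial
  | succ m ih =>
    have hdiff := esymm_sub_prod_mem (k := k) F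
    rw [hF, prod_X_eq_monomial] at hdiff
    refine ⟨fun f hf => ?_, ?_⟩
    · have hmul : monomial (∑ i ∈ F, Finsupp.single i 1) 1 * f ∈
          spanMonomials k (exponentsOffFace F) := by
        have := Ideal.sub_mem _ hf (Ideal.mul_mem_right f _ hdiff)
        convert this using 1
        ring
      refine (mem_spanMonomials_iff_monomial_mul_mem (isUpperSet_exponentsOffFace F)
        (isUpperSet_exponentsOffFace F) (fun c => ?_) f).2 hmul
      refine exists_congr fun j => and_congr_right fun hj => ?_
      rw [Finsupp.add_apply, sum_single_apply, if_neg hj, zero_add]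
    · have hsup : spanMonomials k (exponentsOffFace F) ⊔ Ideal.span {esymm (Fin n) k (m + 1)} =
          spanMonomials k (exponentsOffFaceOrAbove F F) := by
        rw [← spanMonomials_sup_span_monomial (k := k) (U := exponentsOffFace F)
          (a := ∑ i ∈ F, Finsupp.single i 1) (isUpperSet_exponentsOffFaceOrAbove F F)]
        · apply le_antisymm
          · refine sup_le le_sup_left ((Ideal.span_singleton_le_iff_mem _).2 ?_)
            exact mem_sup_span_singleton_iff.2 ⟨1, by simpa using hdiff⟩
          · refine sup_le le_sup_left ((Ideal.span_singleton_le_iff_mem _).2 ?_)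
            exact mem_sup_span_singleton_iff.2
              ⟨1, by simpa using (neg_mem_iff (H := spanMonomials k (exponentsOffFace F))).2 hdiff⟩
        · refine fun c => or_congr Iff.rfl ?_
          rw [Finsupp.le_def]
          refine forall_congr' fun i => ?_
          rw [sum_single_apply]
          by_cases hi : i ∈ F <;> simp [hi, Nat.one_le_iff_ne_zero, Nat.pos_iff_ne_zero]
      rw [hsup]
      refine isRegularModulo_exponentsOffFaceOrAbove (fun a ha => ih _ ?_) F subset_rfl
      rw [Finset.card_erase_of_mem ha, hF, Nat.add_sub_cancel]

end CoordinateSubspaces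

section Matroids

variable {n d : ℕ} {Γ : Finset (Finset (Fin n))}

theorem exists_isMinNonFace_subset {σ : Finset (Fin n)} (hσ : σ ∉ Γ) :
    ∃ γ ⊆ σ, IsMinNonFace Γ γ := by
  induction σ using Finset.strongInduction with
  | H σ ih =>
    by_cases h : ∀ i ∈ σ, σ.erase i ∈ Γ
    · exact ⟨σ, subset_rfl, hσ, h⟩
    · push Not at h
      obtain ⟨i, hi, hiσ⟩ := h
      obtain ⟨γ, hγ, hγΓ⟩ := ih _ (Finset.erase_ssubset hi) hiσ
      exact ⟨γ, hγ.trans (Finset.erase_subset i σ), hγΓ⟩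

theorem IsMinNonFace.eq_of_subset {V : Finset (Fin n)} (hΓ : IsComplexOn V Γ)
    {σ τ : Finset (Fin n)} (hσ : IsMinNonFace Γ σ) (hτ : IsMinNonFace Γ τ) (h : σ ⊆ τ) :
    σ = τ := by
  by_contra hne
  obtain ⟨i, hiτ, hiσ⟩ := Finset.exists_of_ssubset (h.ssubset_of_ne hne)
  exact hσ.1 (hΓ.2.2 _ (hτ.2 i hiτ) σ fun j hj =>
    Finset.mem_erase.2 ⟨fun hji => hiσ (hji ▸ hj), h hj⟩)

/-- Exchanging an element of the circuit of `insert e K`. -/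
theorem IsMatroidOn.erase_insert_mem {V : Finset (Fin n)} (hΓ : IsMatroidOn V Γ)
    {K C : Finset (Fin n)} {e f : Fin n} (hK : K ∈ Γ) (hC : IsMinNonFace Γ C)
    (hCK : C ⊆ insert e K) (hf : f ∈ C) : (insert e K).erase f ∈ Γ := by
  have he : ∀ D, IsMinNonFace Γ D → D ⊆ insert e K → e ∈ D := fun D hD hDK => by
    by_contra heD
    exact hD.1 (hΓ.1.2.2 K hK D fun i hi =>
      (Finset.mem_insert.1 (hDK hi)).resolve_left fun h => heD (h ▸ hi))
  by_contra hnot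
  obtain ⟨D, hDK, hD⟩ := exists_isMinNonFace_subset hnot
  have hfD : f ∉ D := fun h => Finset.notMem_erase f _ (hDK h)
  replace hDK := hDK.trans (Finset.erase_subset _ _)
  obtain ⟨γ, hγ, hγsub⟩ := hΓ.2 C D hC hD (fun h => hfD (h ▸ hf)) e
    (Finset.mem_inter.2 ⟨he C hC hCK, he D hD hDK⟩)
  have heγ := he γ hγ (hγsub.trans ((Finset.erase_subset _ _).trans (Finset.union_subset hCK hDK)))
  exact Finset.notMem_erase e _ (hγsub heγ)

/-- Deleting an element of a circuit does not lower the rank. -/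
theorem IsMatroidOn.exists_face_subset_erase {V : Finset (Fin n)} (hΓ : IsMatroidOn V Γ)
    (hdim : ∀ σ ∈ Γ, σ.card ≤ d) {E σ : Finset (Fin n)} {a : Fin n}
    (hE : ∃ B ∈ Γ, B ⊆ E ∧ B.card = d) (hσ : IsMinNonFace Γ σ) (hσE : σ ⊆ E) (ha : a ∈ σ) :
    ∃ B ∈ Γ, B ⊆ E.erase a ∧ B.card = d := by
  obtain ⟨B, hB, hmax⟩ := Finset.exists_max_image
    (Γ.filter fun B => B ⊆ E ∧ B.card = d) (fun B => (B ∩ σ.erase a).card)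
    (by simpa [Finset.Nonempty] using hE)
  simp only [Finset.mem_filter] at hB hmax
  obtain ⟨hBΓ, hBE, hBd⟩ := hB
  have hsub : σ.erase a ⊆ B := by
    intro e he
    by_contra heB
    have hnot : insert e B ∉ Γ := fun h => by
      have := hdim _ h
      rw [Finset.card_insert_of_notMem heB] at this
      omega
    obtain ⟨C, hCB, hC⟩ := exists_isMinNonFace_subset hnot
    obtain ⟨f, hfC, hfσ⟩ : ∃ f ∈ C, f ∉ σ.erase a := by
      by_contra! h
      exact hC.1 (hΓ.1.2.2 _ (hσ.2 a ha) C h)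
    have hfB : f ∈ insert e B := hCB hfC
    have hcard : ((insert e B).erase f).card = d := by
      rw [Finset.card_erase_of_mem hfB, Finset.card_insert_of_notMem heB, hBd, Nat.add_sub_cancel]
    have hle := hmax _ ⟨hΓ.erase_insert_mem hBΓ hC hCB hfC, (Finset.erase_subset _ _).trans
      (Finset.insert_subset (hσE (Finset.mem_of_mem_erase he)) hBE), hcard⟩
    refine absurd hle (not_le.2 (Finset.card_lt_card ?_))
    refine (Finset.ssubset_iff_of_subset fun i hi => ?_).2 ⟨e, ?_, fun h =>
      heB (Finset.mem_inter.1 h).1⟩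
    · rw [Finset.mem_inter] at hi
      exact Finset.mem_inter.2 ⟨Finset.mem_erase.2 ⟨fun h => hfσ (h ▸ hi.2),
        Finset.mem_insert_of_mem hi.1⟩, hi.2⟩
    · exact Finset.mem_inter.2 ⟨Finset.mem_erase.2 ⟨fun h => hfσ (h ▸ he),
        Finset.mem_insert_self _ _⟩, he⟩
  refine ⟨B, hBΓ, Finset.subset_erase.2 ⟨hBE, fun haB => hσ.1 ?_⟩, hBd⟩
  exact hΓ.1.2.2 B hBΓ σ fun i hi => by
    by_cases hia : i = a
    · exact hia ▸ haB
    · exact hsub (Finset.mem_erase.2 ⟨hia, hi⟩)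

end Matroids

section Deformation

variable {n d : ℕ}

/-- The exponent vector taking the value `ρ σ` on `σ` and `0` elsewhere. -/
noncomputable def constantExponent (ρ : Finset (Fin n) → ℕ) (σ : Finset (Fin n)) : Fin n → ℕ :=
  fun i => if i ∈ σ then ρ σ else 0

/-- Exponents of the colon by `x^c₀` of the deformation of the circuits inside `E`, to which the
variables outside `E` are added. -/
def deformationExponents (Γ : Finset (Finset (Fin n))) (ρ : Finset (Fin n) → ℕ)
    (E : Finset (Fin n)) (c₀ : Fin n →₀ ℕ) : Set (Fin n →₀ ℕ) :=
  {c | (∃ j ∉ E, 0 < c j) ∨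
    ∃ σ, IsMinNonFace Γ σ ∧ σ ⊆ E ∧ ∀ i ∈ σ, ρ σ ≤ c i + c₀ i}

theorem isUpperSet_deformationExponents (Γ : Finset (Finset (Fin n))) (ρ : Finset (Fin n) → ℕ)
    (E : Finset (Fin n)) (c₀ : Fin n →₀ ℕ) : IsUpperSet (deformationExponents Γ ρ E c₀) := by
  rintro c c' hcc (⟨j, hj, hc⟩ | ⟨σ, hσ, hσE, hc⟩)
  · exact Or.inl ⟨j, hj, hc.trans_le (hcc j)⟩
  · exact Or.inr ⟨σ, hσ, hσE, fun i hi => (hc i hi).trans (Nat.add_le_add_right (hcc i) _)⟩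

theorem mem_deformationExponents_colon_iff {Γ : Finset (Finset (Fin n))}
    {ρ : Finset (Fin n) → ℕ} {E : Finset (Fin n)} {c₀ : Fin n →₀ ℕ} {a : Fin n} (ha : a ∈ E)
    (c : Fin n →₀ ℕ) : c ∈ deformationExponents Γ ρ E (Finsupp.single a 1 + c₀) ↔
      Finsupp.single a 1 + c ∈ deformationExponents Γ ρ E c₀ := by
  refine or_congr (exists_congr fun j => and_congr_right fun hj => ?_) ?_
  · rw [Finsupp.add_apply, Finsupp.single_apply, if_neg (by rintro rfl; exact hj ha), zero_add]
  · simp only [Finsupp.add_apply, add_comm, add_left_comm]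

theorem mem_deformationExponents_erase_iff {Γ : Finset (Finset (Fin n))}
    {ρ : Finset (Fin n) → ℕ} {E : Finset (Fin n)} {c₀ : Fin n →₀ ℕ} {a : Fin n}
    (h : ∀ σ, IsMinNonFace Γ σ → σ ⊆ E → a ∈ σ → c₀ a < ρ σ) (c : Fin n →₀ ℕ) :
    c ∈ deformationExponents Γ ρ (E.erase a) c₀ ↔
      c ∈ deformationExponents Γ ρ E c₀ ∨ 0 < c a := by
  constructor
  · rintro (⟨j, hj, hc⟩ | ⟨σ, hσ, hσE, hc⟩)
    · by_cases hja : j = a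
      · exact Or.inr (hja ▸ hc)
      · exact Or.inl (Or.inl ⟨j, fun hjE => hj (Finset.mem_erase.2 ⟨hja, hjE⟩), hc⟩)
    · exact Or.inl (Or.inr ⟨σ, hσ, hσE.trans (Finset.erase_subset a E), hc⟩)
  · rintro ((⟨j, hj, hc⟩ | ⟨σ, hσ, hσE, hc⟩) | hc)
    · exact Or.inl ⟨j, fun h => hj (Finset.mem_of_mem_erase h), hc⟩
    · by_cases haσ : a ∈ σ
      · have := hc a haσ
        have := h σ hσ hσE haσ
        exact Or.inl ⟨a, Finset.notMem_erase a E, by omega⟩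
      · exact Or.inr ⟨σ, hσ, Finset.subset_erase.2 ⟨hσE, haσ⟩, hc⟩
    · exact Or.inl ⟨a, Finset.notMem_erase a E, hc⟩

theorem isRegularModulo_deformationExponents (k : Type*) [Field k]
    {Γ : Finset (Finset (Fin n))} {V : Finset (Fin n)} (hΓ : IsMatroidOn V Γ)
    (hdim : ∀ σ ∈ Γ, σ.card ≤ d) {ρ : Finset (Fin n) → ℕ} (hρ : Function.Injective ρ)
    (E : Finset (Fin n)) (c₀ : Fin n →₀ ℕ) (hE : ∃ B ∈ Γ, B ⊆ E ∧ B.card = d)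
    (hc₀ : ∀ σ, IsMinNonFace Γ σ → σ ⊆ E → ∀ i ∈ σ, c₀ i < ρ σ) :
    IsRegularModulo (spanMonomials k (deformationExponents Γ ρ E c₀)) (esymmList n k d) := by
  induction E using Finset.strongInduction generalizing c₀ with
  | H E ih =>
  by_cases hEΓ : E ∈ Γ
  · obtain ⟨B, hB, hBE, hBd⟩ := hE
    have hempty : deformationExponents Γ ρ E c₀ = exponentsOffFace E := by
      refine Set.ext fun c => or_iff_left ?_
      rintro ⟨σ, hσ, hσE, -⟩
      exact hσ.1 (hΓ.1.2.2 E hEΓ σ hσE)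
    rw [hempty]
    exact isRegularModulo_exponentsOffFace d E
      (le_antisymm (hdim E hEΓ) (hBd ▸ Finset.card_le_card hBE))
  · obtain ⟨σ, hσ, hmin⟩ := Finset.exists_min_image
      (Finset.univ.filter fun σ => IsMinNonFace Γ σ ∧ σ ⊆ E) ρ (by
        obtain ⟨γ, hγE, hγ⟩ := exists_isMinNonFace_subset hEΓ
        exact ⟨γ, by simp [hγ, hγE]⟩)
    simp only [Finset.mem_filter, Finset.mem_univ, true_and] at hσ hmin
    obtain ⟨hσ, hσE⟩ := hσ
    have hlt : ∀ τ, IsMinNonFace Γ τ → τ ⊆ E → τ ≠ σ → ρ σ < ρ τ := fun τ hτ hτE hne =>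
      (hmin τ ⟨hτ, hτE⟩).lt_of_ne fun h => hne (hρ h.symm)
    replace hc₀ : ∀ τ, IsMinNonFace Γ τ → τ ⊆ E → τ ≠ σ → ∀ i ∈ τ, c₀ i < ρ τ :=
      fun τ hτ hτE _ => hc₀ τ hτ hτE
    generalize hN : ∑ i ∈ σ, (ρ σ - c₀ i) = N
    induction N using Nat.strong_induction_on generalizing c₀ with
    | _ N ihN =>
    by_cases hfull : ∀ i ∈ σ, ρ σ ≤ c₀ i
    · rw [spanMonomials_eq_top (Or.inr ⟨σ, hσ, hσE, by simpa using hfull⟩)]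
      exact isRegularModulo_top _
    · push Not at hfull
      obtain ⟨a, ha, hlta⟩ := hfull
      refine IsRegularModulo.of_variable (isUpperSet_deformationExponents _ _ _ _)
        (isUpperSet_deformationExponents Γ ρ E (Finsupp.single a 1 + c₀))
        (isUpperSet_deformationExponents Γ ρ (E.erase a) c₀) a
        (mem_deformationExponents_colon_iff (hσE ha))
        (mem_deformationExponents_erase_iff fun τ hτ hτE haτ => ?_) ?_ ?_
      · by_cases hτσ : τ = σ
        · exact hτσ ▸ hlta
        · exact hc₀ τ hτ hτE hτσ a haτ
      · refine ihN _ ?_ _ (fun τ hτ hτE hτσ i hi => ?_) rfl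
        · rw [← hN]
          refine Finset.sum_lt_sum (fun i _ => ?_) ⟨a, ha, ?_⟩
          · exact Nat.sub_le_sub_left (by simp) _
          · simp only [Finsupp.add_apply, Finsupp.single_eq_same]
            omega
        · have h1 := hlt τ hτ hτE hτσ
          have h2 := hc₀ τ hτ hτE hτσ i hi
          by_cases hia : a = i
          · subst hia
            simp only [Finsupp.add_apply, Finsupp.single_eq_same]
            omega
          · simpa [Finsupp.single_apply, hia] using h2
      · refine ih _ (Finset.erase_ssubset (hσE ha)) c₀
          (hΓ.exists_face_subset_erase hdim hE hσ hσE ha) fun τ hτ hτE => ?_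
        refine hc₀ τ hτ (hτE.trans (Finset.erase_subset a E)) ?_
        rintro rfl
        exact Finset.notMem_erase a E (hτE ha)

theorem monIdeal_eq_spanMonomials (k : Type*) [Field k] (Γ : Finset (Finset (Fin n)))
    (ρ : Finset (Fin n) → ℕ) :
    monIdeal k ((minNonFaces Γ).image (constantExponent ρ)) =
      spanMonomials k (deformationExponents Γ ρ Finset.univ 0) := by
  apply le_antisymm
  · refine Ideal.span_le.2 ?_
    rintro _ ⟨a, ha, rfl⟩
    obtain ⟨σ, hσ, rfl⟩ := Finset.mem_image.1 ha
    refine Ideal.subset_span ⟨_, Or.inr ⟨σ, (Finset.mem_filter.1 hσ).2, Finset.subset_univ σ,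
      fun i hi => ?_⟩, rfl⟩
    simp [constantExponent, hi]
  · refine Ideal.span_le.2 ?_
    rintro _ ⟨c, ⟨j, hj, -⟩ | ⟨σ, hσ, -, hc⟩, rfl⟩
    · exact absurd (Finset.mem_univ j) hj
    · have hle : Finsupp.equivFunOnFinite.symm (constantExponent ρ σ) ≤ c := fun i => by
        by_cases hi : i ∈ σ
        · simpa [constantExponent, hi] using hc i hi
        · simp [constantExponent, hi]
      refine Ideal.mem_of_dvd _ (monomial_dvd_monomial.2 ⟨Or.inr hle, dvd_rfl⟩)
        (Ideal.subset_span ⟨constantExponent ρ σ, ?_, rfl⟩)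
      exact Finset.mem_image_of_mem _ (by simp [minNonFaces, hσ])

end Deformation

section KrullDimension

variable (k : Type*) [Field k] {n d : ℕ}

theorem mono_eq_prod (a : Fin n → ℕ) :
    mono k a = ∏ i, (X i : MvPolynomial (Fin n) k) ^ a i := by
  rw [mono, monomial_eq, map_one, one_mul, Finsupp.prod_fintype _ _ (by simp)]
  rfl

/-- A monomial ideal whose generators have the minimal nonfaces of `Γ` as supports defines a
quotient of dimension `dim Γ + 1`. -/
theorem ringKrullDim_quotient_monIdeal {Γ : Finset (Finset (Fin n))} (hdim : HasDim Γ d)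
    {V : Finset (Fin n)} (hΓ : IsComplexOn V Γ) {e : Finset (Fin n) → Fin n → ℕ}
    (he : ∀ σ ∈ minNonFaces Γ, ∀ i, 0 < e σ i ↔ i ∈ σ) :
    ringKrullDim (MvPolynomial (Fin n) k ⧸ monIdeal k ((minNonFaces Γ).image e)) = d := by
  have hpoly : ∀ F : Finset (Fin n), ringKrullDim (MvPolynomial F k) = F.card := fun F => by
    rw [MvPolynomial.ringKrullDim_of_isNoetherianRing, ringKrullDim_eq_zero_of_field]
    simp
  apply le_antisymm
  · rw [ringKrullDim_quotient]
    refine iSup_le fun s => ?_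
    set p : PrimeSpectrum (MvPolynomial (Fin n) k) := s.head.1 with hp
    set F : Finset (Fin n) := Finset.univ.filter fun i => X i ∉ p.asIdeal with hF
    have hFΓ : F ∈ Γ := by
      by_contra hnot
      obtain ⟨σ, hσF, hσ⟩ := exists_isMinNonFace_subset hnot
      have hσ' : σ ∈ minNonFaces Γ := by simp [minNonFaces, hσ]
      have hmem : mono k (e σ) ∈ p.asIdeal := s.head.2
        (Ideal.subset_span ⟨e σ, Finset.mem_image_of_mem e hσ', rfl⟩)
      rw [mono_eq_prod, p.isPrime.prod_mem_iff] at hmem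
      obtain ⟨i, -, hi⟩ := hmem
      by_cases hiσ : i ∈ σ
      · exact (Finset.mem_filter.1 (hσF hiσ)).2 (p.isPrime.mem_of_pow_mem _ hi)
      · have : e σ i = 0 := Nat.eq_zero_of_not_pos fun h => hiσ ((he σ hσ' i).1 h)
        rw [this, pow_zero] at hi
        exact p.isPrime.ne_top ((Ideal.eq_top_iff_one _).2 hi)
    have hJ : ringKrullDim (MvPolynomial (Fin n) k ⧸ Ideal.span (X '' {i | i ∉ F} :
        Set (MvPolynomial (Fin n) k))) ≤ F.card := by
      rw [← hpoly F]
      let ψ : MvPolynomial F k →ₐ[k] MvPolynomial (Fin n) k ⧸ Ideal.span (X '' {i | i ∉ F} :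
        Set (MvPolynomial (Fin n) k)) := aeval fun i : F => Ideal.Quotient.mk _ (X i.1)
      refine ringKrullDim_le_of_surjective ψ.toRingHom fun y => ?_
      obtain ⟨f, rfl⟩ := Ideal.Quotient.mk_surjective y
      induction f using MvPolynomial.induction_on with
      | C a => exact ⟨C a, ψ.commutes a⟩
      | add f g hf hg =>
        obtain ⟨f', hf'⟩ := hf
        obtain ⟨g', hg'⟩ := hg
        exact ⟨f' + g', by rw [map_add, hf', hg', map_add]⟩
      | mul_X f i hf =>
        obtain ⟨f', hf'⟩ := hf
        by_cases hi : i ∈ F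
        · refine ⟨f' * X ⟨i, hi⟩, ?_⟩
          rw [map_mul, hf', map_mul]
          exact congrArg _ (aeval_X _ _)
        · refine ⟨0, ?_⟩
          rw [map_zero, eq_comm, Ideal.Quotient.eq_zero_iff_mem]
          exact Ideal.mul_mem_left _ _ (Ideal.subset_span ⟨i, hi, rfl⟩)
    rw [ringKrullDim_quotient] at hJ
    have hzero : ∀ i, (s i).1 ∈ PrimeSpectrum.zeroLocus
        (Ideal.span (X '' {i | i ∉ F} : Set (MvPolynomial (Fin n) k)) : Set _) := fun i => by
      refine fun f hf => s.head_le i (?_ : f ∈ p.asIdeal)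
      revert f
      refine Ideal.span_le.2 ?_
      rintro _ ⟨j, hj, rfl⟩
      by_contra hjp
      exact hj (Finset.mem_filter.2 ⟨Finset.mem_univ j, hjp⟩)
    have hlen := Order.LTSeries.length_le_krullDim
      (⟨s.length, fun i => ⟨(s i).1, hzero i⟩, fun i => s.step i⟩ :
        LTSeries (PrimeSpectrum.zeroLocus
          (Ideal.span (X '' {i | i ∉ F} : Set (MvPolynomial (Fin n) k)) : Set _)))
    exact (hlen.trans hJ).trans (by exact_mod_cast hdim.1 F hFΓ)
  · obtain ⟨F, hF, hFd⟩ := hdim.2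
    rw [← hFd, ← hpoly F]
    let φ : MvPolynomial (Fin n) k →ₐ[k] MvPolynomial F k :=
      aeval fun i => if h : i ∈ F then X ⟨i, h⟩ else 0
    have hφ : ∀ a ∈ monIdeal k ((minNonFaces Γ).image e), φ.toRingHom a = 0 := by
      refine fun a ha => (RingHom.mem_ker (f := φ.toRingHom)).1 (?_ : a ∈ RingHom.ker φ.toRingHom)
      revert a
      refine Ideal.span_le.2 ?_
      rintro _ ⟨a, ha, rfl⟩
      obtain ⟨σ, hσ, rfl⟩ := Finset.mem_image.1 ha
      obtain ⟨i, hiσ, hiF⟩ : ∃ i ∈ σ, i ∉ F := by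
        by_contra! h
        exact (Finset.mem_filter.1 hσ).2.1 (hΓ.2.2 F hF σ h)
      change φ (mono k (e σ)) = 0
      rw [mono_eq_prod, map_prod]
      refine Finset.prod_eq_zero (Finset.mem_univ i) ?_
      rw [map_pow, aeval_X, dif_neg hiF, zero_pow ((he σ hσ i).2 hiσ).ne']
    refine ringKrullDim_le_of_surjective (Ideal.Quotient.lift _ φ.toRingHom hφ)
      (Ideal.Quotient.lift_surjective_of_surjective _ _ fun f => ?_)
    refine ⟨rename Subtype.val f, ?_⟩
    change φ (rename Subtype.val f) = f
    rw [aeval_rename]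
    have hX : (fun i => if h : i ∈ F then (X ⟨i, h⟩ : MvPolynomial F k) else 0) ∘ Subtype.val =
        X := funext fun i => by simp
    rw [hX, aeval_X_left_apply]

end KrullDimension

/-- If `Γ` is a matroid complex of dimension `d-1` on `[n]`,
then the Stanley-Reisner ideal `I_Γ` admits a deformation (replacing each
square-free generator, i.e. each minimal non-face, by a monomial with the same
support) that is a generic Cohen-Macaulay monomial ideal. -/
theorem matroid_generic_CM_deformation (k : Type*) [Field k] {n d : ℕ}
    (Γ : Finset (Finset (Fin n))) (hmat : IsMatroidOn Finset.univ Γ)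
    (hdim : HasDim Γ d) :
    ∃ e : Finset (Fin n) → (Fin n → ℕ),
      (∀ σ ∈ minNonFaces Γ, ∀ i : Fin n, 0 < e σ i ↔ i ∈ σ) ∧
      IsGeneric ((minNonFaces Γ).image e) ∧
      IsCMQuotient k (monIdeal k ((minNonFaces Γ).image e)) := by
  let ρ : Finset (Fin n) → ℕ := fun σ => Fintype.equivFin _ σ + 1
  have hρ : Function.Injective ρ := fun σ τ h =>
    (Fintype.equivFin _).injective (Fin.ext (Nat.succ_injective h))
  have he : ∀ σ i, 0 < constantExponent ρ σ i ↔ i ∈ σ := fun σ i => by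
    by_cases hi : i ∈ σ <;> simp [constantExponent, hi, ρ]
  have hsupp : ∀ a ∈ (minNonFaces Γ).image (constantExponent ρ),
      ∃ σ, IsMinNonFace Γ σ ∧ constantExponent ρ σ = a := fun a ha => by
    simpa [minNonFaces] using ha
  refine ⟨constantExponent ρ, fun σ _ => he σ, ⟨?_, ?_⟩, ?_⟩
  · intro a ha b hb hab
    obtain ⟨σ, hσ, rfl⟩ := hsupp a ha
    obtain ⟨τ, hτ, rfl⟩ := hsupp b hb
    rw [hσ.eq_of_subset hmat.1 hτ fun i hi => (he τ i).1 (((he σ i).2 hi).trans_le (hab i))]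
  · rintro a ha b hb hne ⟨i, hi, hpos⟩
    obtain ⟨σ, -, rfl⟩ := hsupp a ha
    obtain ⟨τ, -, rfl⟩ := hsupp b hb
    have hiσ := (he σ i).1 hpos
    have hiτ := (he τ i).1 (hi ▸ hpos)
    simp only [constantExponent, if_pos hiσ, if_pos hiτ] at hi
    exact absurd (congrArg _ (hρ hi)) hne
  · obtain ⟨B, hB, hBd⟩ := hdim.2
    have hreg := isRegularModulo_deformationExponents k hmat hdim.1 hρ Finset.univ 0
      ⟨B, hB, Finset.subset_univ B, hBd⟩ fun σ _ _ i _ => Nat.succ_pos _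
    rw [← monIdeal_eq_spanMonomials] at hreg
    refine ⟨esymmList n k d, fun r hr => mem_span_range_X_of_mem_esymmList hr, ⟨?_, ?_⟩, ?_⟩
    · exact (RingTheory.Sequence.isWeaklyRegular_map_algebraMap_iff _ _ _).2 hreg.isWeaklyRegular
    · have hI : monIdeal k ((minNonFaces Γ).image (constantExponent ρ)) ≤
          RingHom.ker (constantCoeff (R := k) (σ := Fin n)) := by
        refine Ideal.span_le.2 ?_
        rintro _ ⟨a, ha, rfl⟩
        obtain ⟨σ, hσ, rfl⟩ := hsupp a ha
        obtain ⟨i, hi⟩ : σ.Nonempty := Finset.nonempty_iff_ne_empty.2 fun h =>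
          hσ.1 (h ▸ hmat.1.2.2 B hB ∅ (Finset.empty_subset B))
        change constantCoeff (mono k _) = 0
        rw [mono_eq_prod, map_prod]
        refine Finset.prod_eq_zero (Finset.mem_univ i) ?_
        rw [map_pow, constantCoeff_X, zero_pow ((he σ i).2 hi).ne']
      have hX : Ideal.span (Set.range (X : Fin n → MvPolynomial (Fin n) k)) ≤
          RingHom.ker (constantCoeff (R := k) (σ := Fin n)) := by
        refine Ideal.span_le.2 ?_
        rintro _ ⟨i, rfl⟩
        exact constantCoeff_X k i
      have hle : Ideal.ofList ((esymmList n k d).map (Ideal.Quotient.mk _)) ≤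
          RingHom.ker (Ideal.Quotient.lift _ constantCoeff hI) := by
        refine Ideal.span_le.2 fun y hy => ?_
        obtain ⟨r, hr, rfl⟩ := List.mem_map.1 hy
        exact hX (mem_span_range_X_of_mem_esymmList hr)
      intro htop
      rw [smul_eq_mul, Ideal.mul_top] at htop
      exact RingHom.ker_ne_top _ (top_le_iff.1 (htop.trans_le hle))
    · rw [length_esymmList, ringKrullDim_quotient_monIdeal k hdim hmat.1 fun σ _ => he σ]
      rfl
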